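/- arXiv:1711.05092 — 3 statements merged into one kernel-verified Lean document; each statement's English description precedes it below -/
import Mathlib

section
/- For a non-degenerate best-k scoring rule, for every voter i and every collection A_{-i} of the other voters' ballots, every minimal best response (MBR) ballot A_i of voter i to A_{-i} satisfies |A_i| ≤ j*(i). -/
open Finset

/-- The 0-indexed rank of candidate `c` within committee `W` with respect to the utility `u`:
the number of members of `W` strictly preferred to `c`.  Thus the most preferred member of `W`
has rank `0`. -/
noncomputable def owaRank {C : Type*} (u : C → ℝ) (W : Finset C) (c : C) : ℕ :=
  (W.filter fun c' => u c < u c').card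

/-- The OWA set-extension utility determined by the weights `lam` (where `lam 0` is the weight
`λ₁` put on the most preferred committee member, `lam 1` is `λ₂`, and so on) and the
utility function `u`. -/
noncomputable def owaUtil {C : Type*} (lam : ℕ → ℝ) (u : C → ℝ) (W : Finset C) : ℝ :=
  ∑ c ∈ W, lam (owaRank u W c) * u c

/-- The approval score of candidate `c` under the ballot profile `A`. -/
def score {N C : Type*} [Fintype N] [DecidableEq C] (A : N → Finset C) (c : C) : ℕ :=
  (Finset.univ.filter fun i => c ∈ A i).card

/-- Candidate `c` is ranked above candidate `c'` by the best-`k` scoring rule with scoring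
function `g`, with ties broken by the priority order: `c < c'` means `c` has higher
priority (`c ▷ c'`). -/
def beats {N C : Type*} [Fintype N] [DecidableEq C] [LT C]
    (g : C → ℕ → ℝ) (A : N → Finset C) (c c' : C) : Prop :=
  g c' (score A c') < g c (score A c) ∨
    (g c (score A c) = g c' (score A c') ∧ c < c')

open Classical in
/-- The winning committee: the `k` top-ranked candidates. -/
noncomputable def winners {N C : Type*} [Fintype N] [Fintype C] [DecidableEq C] [LT C]
    (g : C → ℕ → ℝ) (k : ℕ) (A : N → Finset C) : Finset C :=
  Finset.univ.filter fun c => (Finset.univ.filter fun c' => beats g A c' c).card < k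

/-- `B` is a best-response ballot of voter `i` against the other voters' ballots in `A`. -/
def BestResponse {N C : Type*} [Fintype N] [DecidableEq N] [Fintype C] [DecidableEq C] [LT C]
    (g : C → ℕ → ℝ) (k : ℕ) (lam : ℕ → ℝ) (u : C → ℝ)
    (A : N → Finset C) (i : N) (B : Finset C) : Prop :=
  ∀ B' : Finset C,
    owaUtil lam u (winners g k (Function.update A i B')) ≤
      owaUtil lam u (winners g k (Function.update A i B))

/-- `B` is a minimal best-response ballot of voter `i`. -/
def MinimalBestResponse {N C : Type*} [Fintype N] [DecidableEq N] [Fintype C] [DecidableEq C]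
    [LT C] (g : C → ℕ → ℝ) (k : ℕ) (lam : ℕ → ℝ) (u : C → ℝ)
    (A : N → Finset C) (i : N) (B : Finset C) : Prop :=
  BestResponse g k lam u A i B ∧
    ∀ B' : Finset C, BestResponse g k lam u A i B' → B.card ≤ B'.card

/-- A ballot profile is a lazy pure Nash equilibrium if every voter's ballot is a minimal
best response to the other voters' ballots. -/
def LazyPNE {N C : Type*} [Fintype N] [DecidableEq N] [Fintype C] [DecidableEq C] [LT C]
    (g : C → ℕ → ℝ) (k : ℕ) (lam : N → ℕ → ℝ) (u : N → C → ℝ) (A : N → Finset C) : Prop :=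
  ∀ i, MinimalBestResponse g k (lam i) (u i) A i (A i)

/-- A ballot is sincere if every approved candidate is preferred to every unapproved one. -/
def Sincere {C : Type*} (u : C → ℝ) (B : Finset C) : Prop :=
  ∀ c ∈ B, ∀ c' ∉ B, u c' < u c

section Rank

variable {C : Type*} (r : C → C → Prop) [DecidableRel r]

/-- The rank function of a strict total order is injective on every finset. -/
lemma injOn_card_filter_rel [IsStrictTotalOrder C r] (S : Finset C) :
    Set.InjOn (fun c => (S.filter fun c' => r c' c).card) S := by
  have key : ∀ a ∈ S, ∀ b, r a b →
      (S.filter fun c' => r c' a).card < (S.filter fun c' => r c' b).card := by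
    intro a ha b hab
    apply Finset.card_lt_card
    rw [Finset.ssubset_iff_of_subset]
    · exact ⟨a, by simp [ha, hab], by simp [irrefl_of r a]⟩
    · intro c hc
      simp only [Finset.mem_filter] at hc ⊢
      exact ⟨hc.1, trans_of r hc.2 hab⟩
  intro a ha b hb hab
  rcases trichotomous_of r a b with h | h | h
  · exact absurd hab (key a ha b h).ne
  · exact h
  · exact absurd hab (key b hb a h).ne'

lemma image_card_filter_rel [IsStrictTotalOrder C r] (S : Finset C) :
    S.image (fun c => (S.filter fun c' => r c' c).card) = Finset.range S.card := by
  apply Finset.eq_of_subset_of_card_le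
  · intro n hn
    obtain ⟨c, hc, rfl⟩ := Finset.mem_image.1 hn
    refine Finset.mem_range.2 (Finset.card_lt_card ?_)
    rw [Finset.ssubset_iff_of_subset (Finset.filter_subset _ _)]
    exact ⟨c, hc, by simp [irrefl_of r c]⟩
  · rw [Finset.card_image_of_injOn (injOn_card_filter_rel r S), Finset.card_range]

lemma card_filter_rank_lt [IsStrictTotalOrder C r] (S : Finset C) {k : ℕ} (hk : k ≤ S.card) :
    (S.filter fun c => (S.filter fun c' => r c' c).card < k).card = k := by
  have hinj := (injOn_card_filter_rel r S).mono
    (Finset.coe_subset.2 (S.filter_subset fun c => (S.filter fun c' => r c' c).card < k))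
  rw [← Finset.card_image_of_injOn hinj]
  convert Finset.card_range k
  ext n
  have h := Finset.ext_iff.1 (image_card_filter_rel r S) n
  simp only [Finset.mem_image, Finset.mem_filter, Finset.mem_range] at h ⊢
  constructor
  · rintro ⟨c, ⟨-, hc⟩, rfl⟩
    exact hc
  · intro hn
    obtain ⟨c, hc, rfl⟩ := h.2 (hn.trans_le hk)
    exact ⟨c, ⟨hc, hn⟩, rfl⟩

end Rank

lemma isStrictTotalOrder_utility {C : Type*} {u : C → ℝ} (hu : Function.Injective u) :
    IsStrictTotalOrder C (fun c' c => u c < u c') where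
  irrefl _ := lt_irrefl _
  trans _ _ _ hab hbc := hbc.trans hab
  trichotomous _ _ hab hba := hu (le_antisymm (not_lt.1 hab) (not_lt.1 hba))

lemma isStrictTotalOrder_beats {N C : Type*} [Fintype N] [LinearOrder C]
    (g : C → ℕ → ℝ) (A : N → Finset C) : IsStrictTotalOrder C (beats g A) where
  irrefl c := by simp [beats]
  trans a b c hab hbc := by
    unfold beats at *
    rcases hab with h | ⟨h, h'⟩ <;> rcases hbc with h2 | ⟨h2, h2'⟩
    · exact Or.inl (h2.trans h)
    · exact Or.inl (h2 ▸ h)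
    · exact Or.inl (h ▸ h2)
    · exact Or.inr ⟨h.trans h2, h'.trans h2'⟩
  trichotomous a b hab hba := by
    unfold beats at *
    push Not at hab hba
    have h : g a (score A a) = g b (score A b) := le_antisymm hab.1 hba.1
    exact le_antisymm (hba.2 h.symm) (hab.2 h)

lemma card_winners {N C : Type*} [Fintype N] [Fintype C] [LinearOrder C]
    (g : C → ℕ → ℝ) {k : ℕ} (hk : k ≤ Fintype.card C) (A : N → Finset C) :
    (winners g k A).card = k := by
  classical
  have := isStrictTotalOrder_beats g A
  have h := card_filter_rank_lt (beats g A) Finset.univ (by simpa using hk)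
  convert h using 2
  unfold winners
  congr!

/-- A winner stays a winner when its score is unchanged and no other score increases. -/
lemma mem_winners_of_score_le {N C : Type*} [Fintype N] [Fintype C] [LinearOrder C]
    {g : C → ℕ → ℝ} (hg : ∀ c, Monotone (g c)) {k : ℕ} {A A' : N → Finset C} {c : C}
    (hc : score A' c = score A c) (hle : ∀ d, score A' d ≤ score A d)
    (hw : c ∈ winners g k A) : c ∈ winners g k A' := by
  classical
  simp only [winners, Finset.mem_filter, Finset.mem_univ, true_and] at hw ⊢
  refine lt_of_le_of_lt (Finset.card_le_card fun d hd => ?_) hw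
  refine Finset.mem_filter.2 ⟨Finset.mem_univ _, ?_⟩
  simp only [Finset.mem_filter, Finset.mem_univ, true_and, beats, hc] at hd
  have hd' := hg d (hle d)
  rcases hd with h | ⟨h, h'⟩
  · exact Or.inl (h.trans_le hd')
  · rcases hd'.lt_or_eq with h2 | h2
    · exact Or.inl (h ▸ h2)
    · exact Or.inr ⟨h2 ▸ h, h'⟩

/-- The OWA utility as a sum over positions of the committee. -/
lemma exists_owaUtil_eq_sum_range {C : Type*} [Nonempty C] (lam : ℕ → ℝ) {u : C → ℝ}
    (hu : Function.Injective u) (W : Finset C) :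
    ∃ e : ℕ → C, (∀ n < W.card, e n ∈ W ∧ owaRank u W (e n) = n) ∧
      owaUtil lam u W = ∑ n ∈ Finset.range W.card, lam n * u (e n) := by
  classical
  have := isStrictTotalOrder_utility hu
  have himg : W.image (owaRank u W) = Finset.range W.card := by
    convert image_card_filter_rel (fun c' c => u c < u c') W using 2
    unfold owaRank
    congr!
  have hinj : Set.InjOn (owaRank u W) W := by
    convert injOn_card_filter_rel (fun c' c => u c < u c') W using 2
    unfold owaRank
    congr!
  have hex : ∀ n, ∃ c, n < W.card → c ∈ W ∧ owaRank u W c = n := by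
    intro n
    by_cases hn : n < W.card
    · rw [← Finset.mem_range, ← himg, Finset.mem_image] at hn
      obtain ⟨c, hc⟩ := hn
      exact ⟨c, fun _ => hc⟩
    · exact ⟨Classical.arbitrary C, fun h => absurd h hn⟩
  choose e he using hex
  refine ⟨e, he, ?_⟩
  rw [← himg, Finset.sum_image hinj, owaUtil]
  refine Finset.sum_congr rfl fun c hc => ?_
  have hlt : owaRank u W c < W.card :=
    Finset.mem_range.1 (himg ▸ Finset.mem_image_of_mem _ hc)
  rw [hinj (he _ hlt).1 hc (he _ hlt).2]

/-- If the weights vanish from position `j` on, then a committee of the same size containing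
the `j` most preferred members of `W` is at least as good as `W`. -/
lemma owaUtil_le_of_top_subset {C : Type*} {lam : ℕ → ℝ} (hlam : ∀ n, 0 ≤ lam n) {u : C → ℝ}
    (hu : Function.Injective u) {j : ℕ} (hz : ∀ n, j ≤ n → lam n = 0) {W W' : Finset C}
    (hcard : W'.card = W.card) (hsub : ∀ c ∈ W, owaRank u W c < j → c ∈ W') :
    owaUtil lam u W ≤ owaUtil lam u W' := by
  classical
  rcases isEmpty_or_nonempty C with hC | hC
  · simp [owaUtil, Finset.eq_empty_of_isEmpty]
  obtain ⟨e, he, hsum⟩ := exists_owaUtil_eq_sum_range lam hu W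
  obtain ⟨e', he', hsum'⟩ := exists_owaUtil_eq_sum_range lam hu W'
  rw [hsum, hsum', hcard]
  refine Finset.sum_le_sum fun n hn => ?_
  rw [Finset.mem_range] at hn
  rcases le_or_gt j n with hjn | hnj
  · simp [hz n hjn]
  refine mul_le_mul_of_nonneg_left ?_ (hlam n)
  by_contra! hlt
  obtain ⟨hmem, hrank⟩ := he n hn
  have hrank' := (he' n (hcard ▸ hn)).2
  have hss : insert (e n) (W.filter fun c => u (e n) < u c) ⊆
      W'.filter fun c => u (e' n) < u c := by
    intro c hc
    rw [Finset.mem_insert, Finset.mem_filter] at hc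
    have hc' : c ∈ W ∧ u (e n) ≤ u c := by
      rcases hc with rfl | hc
      · exact ⟨hmem, le_rfl⟩
      · exact ⟨hc.1, hc.2.le⟩
    refine Finset.mem_filter.2 ⟨hsub c hc'.1 (lt_of_le_of_lt ?_ hnj), hlt.trans_le hc'.2⟩
    rw [← hrank]
    refine Finset.card_le_card fun d hd => ?_
    rw [Finset.mem_filter] at hd ⊢
    exact ⟨hd.1, hc'.2.trans_lt hd.2⟩
  have hle := Finset.card_le_card hss
  rw [Finset.card_insert_of_notMem (by simp)] at hle
  unfold owaRank at hrank hrank'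
  omega

/-- every minimal best-response ballot has length at most `j*(i)`. -/
theorem statement_3 {N C : Type*} [Fintype N] [DecidableEq N] [Fintype C] [LinearOrder C]
    (k : ℕ) (hk1 : 1 ≤ k) (hk2 : k ≤ Fintype.card C)
    (g : C → ℕ → ℝ) (hg : ∀ c, StrictMono (g c)) (hg0 : ∀ c, g c 0 = 0)
    (u : C → ℝ) (hu : Function.Injective u)
    (lam : ℕ → ℝ) (hlam : ∀ n, 0 ≤ lam n)
    (jstar : ℕ) (hj1 : 1 ≤ jstar) (hjk : jstar ≤ k)
    (hz : ∀ n, jstar ≤ n → lam n = 0) (hpos : 0 < lam (jstar - 1))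
    (A : N → Finset C) (i : N) (B : Finset C)
    (hB : MinimalBestResponse g k lam u A i B) :
    B.card ≤ jstar := by
  classical
  obtain ⟨hbr, hmin⟩ := hB
  set W := winners g k (Function.update A i B) with hW
  have hWcard : W.card = k := card_winners g hk2 _
  have := isStrictTotalOrder_utility hu
  have hTcard : (W.filter fun c => owaRank u W c < jstar).card = jstar := by
    convert card_filter_rank_lt (fun c' c => u c < u c') W (hWcard ▸ hjk) using 4
    unfold owaRank
    congr!
  set T := W.filter fun c => owaRank u W c < jstar with hT
  have hmem : ∀ c m, c ∈ Function.update A i (B ∩ T) m → c ∈ Function.update A i B m := by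
    intro c m
    by_cases h : m = i
    · subst h
      simp +contextual
    · simp [h]
  have hmem' : ∀ c ∈ T, ∀ m,
      c ∈ Function.update A i (B ∩ T) m ↔ c ∈ Function.update A i B m := by
    intro c hc m
    by_cases h : m = i
    · subst h
      simp [hc]
    · simp [h]
  have hbr' : BestResponse g k lam u A i (B ∩ T) := by
    intro B'
    refine (hbr B').trans (owaUtil_le_of_top_subset hlam hu hz ?_ fun c hc hrank => ?_)
    · rw [card_winners g hk2, card_winners g hk2]
    · refine mem_winners_of_score_le (fun c => (hg c).monotone) ?_ (fun d => ?_) hc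
      · simp only [score, hmem' c (Finset.mem_filter.2 ⟨hc, hrank⟩)]
      · exact Finset.card_le_card (Finset.monotone_filter_right _ fun m _ => hmem d m)
  exact (hmin _ hbr').trans ((Finset.card_le_card Finset.inter_subset_right).trans hTcard.le)
end

section
/- Let i be a voter, let W' ⊆ C be a committee of size k, let c* ∈ W_i* with c* ∉ W', and let c ∈ W' with u_i(c*) > u_i(c). Set W = (W' \ {c}) ∪ {c*}. Then U_i(W) ≥ U_i(W'); moreover, if voter i has a full-rank set-extension, then U_i(W) > U_i(W'). -/
open Finset

theorem owaRank_lt_card {C : Type*} (u : C → ℝ) {W : Finset C} {c : C} (hc : c ∈ W) :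
    owaRank u W c < W.card :=
  Finset.card_lt_card <| Finset.filter_ssubset.2 ⟨c, hc, lt_irrefl _⟩

theorem owaRank_lt_owaRank {C : Type*} (u : C → ℝ) {W : Finset C} {c d : C} (hd : d ∈ W)
    (h : u c < u d) : owaRank u W d < owaRank u W c := by
  refine Finset.card_lt_card ((Finset.ssubset_iff_of_subset ?_).2 ⟨d, ?_, ?_⟩)
  · intro x hx
    rw [Finset.mem_filter] at hx ⊢
    exact ⟨hx.1, h.trans hx.2⟩
  · simp [hd, h]
  · simp

theorem owaRank_injOn {C : Type*} {u : C → ℝ} (hu : Function.Injective u) (W : Finset C) :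
    Set.InjOn (owaRank u W) W := by
  intro c hc d hd h
  by_contra hne
  rcases lt_or_gt_of_ne (hu.ne hne) with hlt | hlt
  · exact (owaRank_lt_owaRank u hd hlt).ne' h
  · exact (owaRank_lt_owaRank u hc hlt).ne h

theorem exists_mem_owaRank_eq {C : Type*} {u : C → ℝ} (hu : Function.Injective u)
    (W : Finset C) {j : ℕ} (hj : j < W.card) : ∃ c ∈ W, owaRank u W c = j := by
  obtain ⟨c, hc, h⟩ := Finset.surjOn_of_injOn_of_card_le (t := Finset.range W.card)
    (owaRank u W) (fun c hc => by simpa using owaRank_lt_card u hc) (owaRank_injOn hu W)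
    (by simp) (by simpa using hj : j ∈ (↑(Finset.range W.card) : Set ℕ))
  exact ⟨c, hc, h⟩

/-- Any enumeration of a committee by rank computes its OWA utility position by position. -/
theorem owaUtil_eq_sum_range {C : Type*} {u : C → ℝ} (hu : Function.Injective u)
    (lam : ℕ → ℝ) {W : Finset C} {s : ℕ → C} (hs : ∀ j < W.card, s j ∈ W)
    (hrank : ∀ j < W.card, owaRank u W (s j) = j) :
    owaUtil lam u W = ∑ j ∈ Finset.range W.card, lam j * u (s j) := by
  have hinv : ∀ c ∈ W, s (owaRank u W c) = c := fun c hc =>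
    have hlt := owaRank_lt_card u hc
    owaRank_injOn hu W (hs _ hlt) hc (hrank _ hlt)
  refine Finset.sum_bij' (fun c _ => owaRank u W c) (fun j _ => s j) ?_ ?_ hinv ?_ ?_
  · exact fun c hc => Finset.mem_range.2 (owaRank_lt_card u hc)
  · exact fun j hj => hs j (Finset.mem_range.1 hj)
  · exact fun j hj => hrank j (Finset.mem_range.1 hj)
  · exact fun c hc => by rw [hinv c hc]

/-- If every upper level set of `W` is at least as large as that of `W'`, then each member of
`W'` is at most as good as the member of `W` of the same rank. -/
theorem le_of_owaRank_eq {C : Type*} {u : C → ℝ} {W W' : Finset C}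
    (hdom : ∀ t : ℝ, (W'.filter fun x => t ≤ u x).card ≤ (W.filter fun x => t ≤ u x).card)
    {x y : C} (hx : x ∈ W') (h : owaRank u W' x = owaRank u W y) : u x ≤ u y := by
  by_contra! hlt
  have hlower : owaRank u W' x < (W'.filter fun z => u x ≤ u z).card := by
    refine Finset.card_lt_card ((Finset.ssubset_iff_of_subset ?_).2 ⟨x, ?_, ?_⟩)
    · exact Finset.monotone_filter_right _ fun z _ hz => le_of_lt hz
    · simp [hx]
    · simp
  have hupper : (W.filter fun z => u x ≤ u z).card ≤ owaRank u W y :=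
    Finset.card_le_card <| Finset.monotone_filter_right _ fun z _ hz => hlt.trans_le hz
  have := hdom (u x)
  omega

theorem card_filter_le_card_filter_insert_erase {C : Type*} [DecidableEq C] {u : C → ℝ}
    {W : Finset C} {c d : C} (hd : d ∉ W) (h : u c < u d) (t : ℝ) :
    (W.filter fun x => t ≤ u x).card ≤
      ((insert d (W.erase c)).filter fun x => t ≤ u x).card := by
  refine Finset.card_le_card_of_injOn (fun x => if x = c then d else x) ?_ ?_
  · intro x hx
    have hx' := Finset.mem_filter.1 hx
    by_cases hxc : x = c
    · subst hxc
      simpa using hx'.2.trans h.le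
    · simp [hxc, hx'.1, hx'.2]
  · intro x hx y hy hxy
    have hx' := (Finset.mem_filter.1 hx).1
    have hy' := (Finset.mem_filter.1 hy).1
    dsimp only at hxy
    split_ifs at hxy <;> grind

/-- swapping into a committee a member of the ideal set `W_i*` in place of a less
preferred member weakly increases utility, and strictly so under the full-rank assumption. -/
theorem statement_10 {C : Type*} [Fintype C] [DecidableEq C]
    (k : ℕ) (hk1 : 1 ≤ k) (hk2 : k ≤ Fintype.card C)
    (u : C → ℝ) (hu : Function.Injective u)
    (lam : ℕ → ℝ) (hlam : ∀ n, 0 ≤ lam n)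
    (jstar : ℕ) (hj1 : 1 ≤ jstar) (hjk : jstar ≤ k)
    (hz : ∀ n, jstar ≤ n → lam n = 0) (hpos : 0 < lam (jstar - 1))
    (Wst : Finset C) (hWstcard : Wst.card = jstar)
    (hWsttop : ∀ c ∈ Wst, ∀ c' ∉ Wst, u c' < u c)
    (W' : Finset C) (hW' : W'.card = k)
    (cstar : C) (hcstar : cstar ∈ Wst) (hcstar' : cstar ∉ W')
    (c : C) (hcW' : c ∈ W') (hlt : u c < u cstar) :
    owaUtil lam u W' ≤ owaUtil lam u (insert cstar (W'.erase c)) ∧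
      ((∀ n < jstar, 0 < lam n) →
        owaUtil lam u W' < owaUtil lam u (insert cstar (W'.erase c))) := by
  set W := insert cstar (W'.erase c) with hW
  have hcard : W.card = W'.card := by
    rw [hW, Finset.card_insert_of_notMem (by simp [hcstar']), Finset.card_erase_add_one hcW']
  have : Nonempty C := ⟨c⟩
  choose! s hs hsrank using fun j => exists_mem_owaRank_eq hu W (j := j)
  choose! s' hs' hsrank' using fun j => exists_mem_owaRank_eq hu W' (j := j)
  have hle : ∀ j < W'.card, u (s' j) ≤ u (s j) := fun j hj =>
    le_of_owaRank_eq (card_filter_le_card_filter_insert_erase hcstar' hlt) (hs' j hj)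
      ((hsrank' j hj).trans (hsrank j (hcard ▸ hj)).symm)
  have hterm : ∀ j ∈ Finset.range W'.card, lam j * u (s' j) ≤ lam j * u (s j) := fun j hj =>
    mul_le_mul_of_nonneg_left (hle j (Finset.mem_range.1 hj)) (hlam j)
  rw [owaUtil_eq_sum_range hu lam hs hsrank, owaUtil_eq_sum_range hu lam hs' hsrank', hcard]
  refine ⟨Finset.sum_le_sum hterm, fun hfull => Finset.sum_lt_sum hterm ?_⟩
  have hmem : cstar ∈ W := Finset.mem_insert_self _ _
  have hr : owaRank u W cstar < W.card := owaRank_lt_card u hmem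
  have hr' : owaRank u W cstar < W'.card := hcard ▸ hr
  have hrj : owaRank u W cstar < jstar := by
    rw [← hWstcard]
    refine Finset.card_lt_card ((Finset.ssubset_iff_of_subset ?_).2 ⟨cstar, hcstar, by simp⟩)
    intro y hy
    by_contra hyW
    exact (hWsttop cstar hcstar y hyW).not_gt (Finset.mem_filter.1 hy).2
  have hscstar : s (owaRank u W cstar) = cstar :=
    owaRank_injOn hu W (hs _ hr) hmem (hsrank _ hr)
  refine ⟨owaRank u W cstar, Finset.mem_range.2 hr',
    mul_lt_mul_of_pos_left (lt_of_le_of_ne (hle _ hr') (hu.ne ?_)) (hfull _ hrj)⟩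
  rw [hscstar]
  exact fun h => hcstar' (h ▸ hs' _ hr')
end

section
/- For the AV-rule with lexicographic tie-breaking, assume every voter has a full-rank set-extension. Suppose A is a lazy-PNE whose outcome W = W_A satisfies W ⊊ W*, and let w be the ▷-lowest-priority candidate in W. Then for every voter i such that w is among voter i's j*(i) most preferred candidates of W, and every candidate c ∈ C \ W with c ▷ w, we have u_i(w) > u_i(c). -/
open Finset

section OwaSwap

variable {C : Type*} [DecidableEq C] {u : C → ℝ} {W : Finset C} {a b : C}

theorem owaRank_swap (ha : a ∈ W) (hb : b ∉ W) {x : C} (hx : u x < u a ↔ u x < u b) :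
    owaRank u (insert b (W.erase a)) x = owaRank u W x := by
  unfold owaRank
  rw [filter_insert, filter_erase]
  by_cases h : u x < u b
  · have ha' : a ∈ W.filter fun y => u x < u y := by simp [ha, hx.2 h]
    rw [if_pos h, card_insert_of_notMem (by simp [hb]), card_erase_add_one ha']
  · have ha' : a ∉ W.filter fun y => u x < u y := by simp [hx, h]
    rw [if_neg h, erase_eq_of_notMem ha']

/-- Exchanging `a` for an outsider `b` with no member of `W` between them in utility changes the
OWA utility only through the term of the exchanged candidate. -/
theorem owaUtil_swap_of_adjacent (lam : ℕ → ℝ) (hu : Function.Injective u)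
    (ha : a ∈ W) (hb : b ∉ W) (hab : u a < u b) (hadj : ∀ x ∈ W, u a < u x → u b < u x) :
    owaUtil lam u (insert b (W.erase a)) =
      owaUtil lam u W + lam (owaRank u W a) * (u b - u a) := by
  have hrank : owaRank u (insert b (W.erase a)) b = owaRank u W a := by
    unfold owaRank
    congr 1
    ext y
    simp only [mem_filter, mem_insert, mem_erase]
    constructor
    · rintro ⟨rfl | ⟨-, hy⟩, hlt⟩
      · exact absurd hlt (lt_irrefl _)
      · exact ⟨hy, hab.trans hlt⟩
    · rintro ⟨hy, hlt⟩
      exact ⟨Or.inr ⟨fun h => by simp [h] at hlt, hy⟩, hadj y hy hlt⟩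
  unfold owaUtil
  rw [sum_insert (by simp [hb]), hrank, ← add_sum_erase W _ ha]
  have hsum : ∑ x ∈ W.erase a, lam (owaRank u (insert b (W.erase a)) x) * u x =
      ∑ x ∈ W.erase a, lam (owaRank u W x) * u x := by
    refine sum_congr rfl fun x hx => ?_
    obtain ⟨hxa, hxW⟩ := mem_erase.1 hx
    rw [owaRank_swap ha hb ⟨fun h => h.trans hab, fun h => ?_⟩]
    rcases lt_trichotomy (u x) (u a) with h' | h' | h'
    · exact h'
    · exact absurd (hu h') hxa
    · exact absurd (hadj x hxW h') h.not_gt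
  rw [hsum]
  ring

/-- Exchanging a member `a` whose position carries positive weight for a more preferred outsider
strictly increases the OWA utility. -/
theorem owaUtil_lt_owaUtil_swap {lam : ℕ → ℝ} (hlam : ∀ n, 0 ≤ lam n)
    (hu : Function.Injective u) (ha : a ∈ W) (hb : b ∉ W) (hab : u a < u b)
    (hpos : 0 < lam (owaRank u W a)) :
    owaUtil lam u W < owaUtil lam u (insert b (W.erase a)) := by
  induction hn : (W.filter fun x => u a < u x ∧ u x < u b).card using Nat.strong_induction_on
    generalizing W b with
  | _ n ih =>
    by_cases hadj : ∀ x ∈ W, u a < u x → u b < u x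
    · rw [owaUtil_swap_of_adjacent lam hu ha hb hab hadj]
      have := mul_pos hpos (sub_pos.2 hab)
      linarith
    · push Not at hadj
      obtain ⟨x, hxW, hax, hxb⟩ := hadj
      have hxb' : u x < u b := lt_of_le_of_ne hxb fun h => hb (hu h ▸ hxW)
      obtain ⟨d, hd, hmax⟩ := exists_max_image (W.filter fun x => u a < u x ∧ u x < u b) u
        ⟨x, by simp [hxW, hax, hxb']⟩
      obtain ⟨hdW, had, hdb⟩ := mem_filter.1 hd
      have hda : a ≠ d := fun h => by simp [h] at had
      have hdb' : d ≠ b := fun h => by simp [h] at hdb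
      have hstep := owaUtil_swap_of_adjacent lam hu hdW hb hdb fun y hy hdy => by
        by_contra hyb
        have hyb' : u y < u b := lt_of_le_of_ne (not_lt.1 hyb) fun h => hb (hu h ▸ hy)
        exact (hmax y (by simp [hy, had.trans hdy, hyb'])).not_gt hdy
      have hle := mul_nonneg (hlam (owaRank u W d)) (sub_pos.2 hdb).le
      have hrank : owaRank u (insert b (W.erase d)) a = owaRank u W a :=
        owaRank_swap hdW hb (by simp [had, hab])
      have hcard : ((insert b (W.erase d)).filter fun x => u a < u x ∧ u x < u d).card < n := by
        rw [← hn]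
        refine card_lt_card ⟨fun y hy => ?_, fun h => ?_⟩
        · simp only [mem_filter, mem_insert, mem_erase] at hy ⊢
          obtain ⟨rfl | ⟨-, hyW⟩, hay, hyd⟩ := hy
          · exact absurd hyd hdb.not_gt
          · exact ⟨hyW, hay, hyd.trans hdb⟩
        · have := (mem_filter.1 (h hd)).2.2
          exact lt_irrefl _ this
      have hlt := ih _ hcard (W := insert b (W.erase d)) (b := d) (by simp [ha, hda])
        (by simp [hdb']) had (by rwa [hrank]) rfl
      have hset : insert d ((insert b (W.erase d)).erase a) = insert b (W.erase a) := by
        ext y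
        simp only [mem_insert, mem_erase]
        have hba : b ≠ a := fun h => by simp [h] at hab
        by_cases hyd : y = d
        · subst hyd; simp [hdW, hda.symm]
        · by_cases hyb : y = b
          · subst hyb; simp [hba]
          · simp [hyd, hyb]
      rw [hset] at hlt
      linarith

end OwaSwap

theorem score_update_add {N C : Type*} [Fintype N] [DecidableEq N] [DecidableEq C]
    (A : N → Finset C) (i : N) (B : Finset C) (y : C) :
    score (Function.update A i B) y + (if y ∈ A i then 1 else 0) =
      score A y + (if y ∈ B then 1 else 0) := by
  unfold score
  simp only [card_filter]
  rw [← add_sum_erase univ _ (mem_univ i),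
    ← add_sum_erase univ (fun j => if y ∈ A j then 1 else 0) (mem_univ i)]
  have h : ∑ j ∈ univ.erase i, (if y ∈ Function.update A i B j then 1 else 0) =
      ∑ j ∈ univ.erase i, (if y ∈ A j then 1 else 0) :=
    sum_congr rfl fun j hj => by rw [Function.update_of_ne (ne_of_mem_erase hj)]
  rw [h, Function.update_self]
  omega

section ApprovalVoting

variable {N C : Type*} [Fintype N] [LinearOrder C]

theorem beats_cast_iff {A : N → Finset C} {c c' : C} :
    beats (fun _ n => (n : ℝ)) A c c' ↔
      score A c' < score A c ∨ (score A c = score A c' ∧ c < c') := by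
  simp [beats]

theorem beats_cast_irrefl {A : N → Finset C} (c : C) :
    ¬ beats (fun _ n => (n : ℝ)) A c c := by
  simp [beats]

theorem beats_cast_trans {A : N → Finset C} {a b c : C}
    (hab : beats (fun _ n => (n : ℝ)) A a b) (hbc : beats (fun _ n => (n : ℝ)) A b c) :
    beats (fun _ n => (n : ℝ)) A a c := by
  rw [beats_cast_iff] at *
  grind

theorem beats_cast_total {A : N → Finset C} {a b : C} (h : a ≠ b) :
    beats (fun _ n => (n : ℝ)) A a b ∨ beats (fun _ n => (n : ℝ)) A b a := by
  simp only [beats_cast_iff]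
  grind

variable [Fintype C] {k : ℕ} {A : N → Finset C}

open Classical in
theorem beaters_ssubset {a b : C} (h : beats (fun _ n => (n : ℝ)) A a b) :
    (univ.filter fun c => beats (fun _ n => (n : ℝ)) A c a) ⊂
      univ.filter fun c => beats (fun _ n => (n : ℝ)) A c b := by
  refine ⟨fun y hy => ?_, fun hsub => ?_⟩
  · simp only [mem_filter, mem_univ, true_and] at hy ⊢
    exact beats_cast_trans hy h
  · exact beats_cast_irrefl a (mem_filter.1 (hsub (by simpa using h))).2

theorem card_winners_s14 (hk : k ≤ Fintype.card C) :
    (winners (fun _ n => (n : ℝ)) k A).card = k := by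
  classical
  let r : C → ℕ := fun c => (univ.filter fun c' => beats (fun _ n => (n : ℝ)) A c' c).card
  have hr : Function.Injective r := fun a b hab => by
    by_contra hne
    rcases beats_cast_total (A := A) hne with h | h
    · exact (card_lt_card (beaters_ssubset h)).ne hab
    · exact (card_lt_card (beaters_ssubset h)).ne' hab
  have himage : univ.image r = range (Fintype.card C) := by
    refine eq_of_subset_of_card_le (fun m hm => ?_) (by simp [card_image_of_injective _ hr])
    obtain ⟨c, -, rfl⟩ := mem_image.1 hm
    exact mem_range.2 (card_lt_univ_of_notMem (x := c) (by simp [beats_cast_irrefl]))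
  have hwin : (winners (fun _ n => (n : ℝ)) k A).image r = range k := by
    ext m
    simp only [mem_image, mem_range, winners, mem_filter, mem_univ, true_and]
    constructor
    · rintro ⟨c, hc, rfl⟩
      convert hc
    · intro hm
      have hm' : m ∈ univ.image r := by rw [himage]; exact mem_range.2 (hm.trans_le hk)
      obtain ⟨c, -, rfl⟩ := mem_image.1 hm'
      exact ⟨c, by convert hm, rfl⟩
  rw [← card_image_of_injective _ hr, hwin, card_range]

theorem beats_of_mem_winners {x y : C} (hx : x ∈ winners (fun _ n => (n : ℝ)) k A)
    (hy : y ∉ winners (fun _ n => (n : ℝ)) k A) : beats (fun _ n => (n : ℝ)) A x y := by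
  classical
  have hne : x ≠ y := fun h => hy (h ▸ hx)
  refine (beats_cast_total hne).resolve_right fun h => ?_
  have hlt := card_lt_card (beaters_ssubset h)
  simp only [winners, mem_filter, mem_univ, true_and, not_lt] at hx hy
  convert (hlt.trans (lt_of_lt_of_le (by convert hx) hy)).false

theorem winners_eq_of_forall_beats {S : Finset C} (hS : S.card = k)
    (h : ∀ x ∈ S, ∀ y ∉ S, beats (fun _ n => (n : ℝ)) A x y) :
    winners (fun _ n => (n : ℝ)) k A = S := by
  classical
  ext x
  simp only [winners, mem_filter, mem_univ, true_and]
  constructor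
  · intro hx
    by_contra hxS
    refine (hS.symm.le.trans (card_le_card fun y hy => ?_)).not_gt hx
    simpa using h y hy x hxS
  · intro hx
    rw [← hS]
    refine card_lt_card ⟨fun y hy => ?_, fun hsub => ?_⟩
    · by_contra hyS
      exact beats_cast_irrefl x (beats_cast_trans (h x hx y hyS) (mem_filter.1 hy).2)
    · exact beats_cast_irrefl x (mem_filter.1 (hsub hx)).2

variable [DecidableEq N] {lam : N → ℕ → ℝ} {u : N → C → ℝ}

/-- In a lazy equilibrium, withdrawing an approval always changes the outcome. -/
theorem LazyPNE.winners_erase_ne (hA : LazyPNE (fun _ n => (n : ℝ)) k lam u A)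
    {j : N} {x : C} (hx : x ∈ A j) :
    winners (fun _ n => (n : ℝ)) k (Function.update A j ((A j).erase x)) ≠
      winners (fun _ n => (n : ℝ)) k A := by
  intro h
  obtain ⟨hbr, hmin⟩ := hA j
  refine (hmin ((A j).erase x) fun B => ?_).not_gt (card_erase_lt_of_mem hx)
  have := hbr B
  rwa [Function.update_eq_self, ← h] at this

theorem LazyPNE.subset_winners (hA : LazyPNE (fun _ n => (n : ℝ)) k lam u A)
    (hk : k ≤ Fintype.card C) (j : N) : A j ⊆ winners (fun _ n => (n : ℝ)) k A := by
  intro x hx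
  by_contra hxW
  refine hA.winners_erase_ne hx (winners_eq_of_forall_beats (card_winners_s14 hk) fun p hp q hq => ?_)
  have hb := beats_of_mem_winners hp hq
  have hpx : p ≠ x := fun h => hxW (h ▸ hp)
  have hsp := score_update_add A j ((A j).erase x) p
  have hsq := score_update_add A j ((A j).erase x) q
  rw [beats_cast_iff] at hb ⊢
  simp only [mem_erase] at hsp hsq
  grind

theorem LazyPNE.score_eq_zero (hA : LazyPNE (fun _ n => (n : ℝ)) k lam u A)
    (hk : k ≤ Fintype.card C) {y : C} (hy : y ∉ winners (fun _ n => (n : ℝ)) k A) :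
    score A y = 0 := by
  rw [score, card_eq_zero, filter_eq_empty_iff]
  exact fun j _ hj => hy (hA.subset_winners hk j hj)

theorem LazyPNE.score_le_one (hA : LazyPNE (fun _ n => (n : ℝ)) k lam u A)
    (hk : k ≤ Fintype.card C) (x : C) : score A x ≤ 1 := by
  by_contra! hx
  have hne : (univ.filter fun j => x ∈ A j).Nonempty := card_pos.1 (Nat.zero_lt_one.trans hx)
  obtain ⟨j, hj⟩ := hne
  have hj := (mem_filter.1 hj).2
  refine hA.winners_erase_ne hj (winners_eq_of_forall_beats (card_winners_s14 hk) fun p hp q hq => ?_)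
  have hb := beats_of_mem_winners hp hq
  have hq0 := hA.score_eq_zero hk hq
  have hsp := score_update_add A j ((A j).erase x) p
  have hsq := score_update_add A j ((A j).erase x) q
  rw [beats_cast_iff] at hb ⊢
  simp only [mem_erase] at hsp hsq
  grind

end ApprovalVoting

/-- under the full-rank assumption, if a lazy-PNE outcome `W` satisfies
`W ⊊ W*` and `w` is the lowest-priority member of `W`, then for every voter `i` for whom `w`
is among the `j*(i)` most preferred members of `W`, every unelected candidate with higher
priority than `w` is strictly less preferred than `w` by voter `i`. -/
theorem statement_14 {N C : Type*} [Fintype N] [DecidableEq N] [Fintype C] [LinearOrder C]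
    (k : ℕ) (hk1 : 1 ≤ k) (hk2 : k ≤ Fintype.card C)
    (u : N → C → ℝ) (hu : ∀ i, Function.Injective (u i))
    (lam : N → ℕ → ℝ) (hlam : ∀ i n, 0 ≤ lam i n)
    (jstar : N → ℕ) (hj1 : ∀ i, 1 ≤ jstar i) (hjk : ∀ i, jstar i ≤ k)
    (hz : ∀ i n, jstar i ≤ n → lam i n = 0)
    (hfull : ∀ i n, n < jstar i → 0 < lam i n)
    (Wst : N → Finset C) (hWstcard : ∀ i, (Wst i).card = jstar i)
    (hWsttop : ∀ i, ∀ c ∈ Wst i, ∀ c' ∉ Wst i, u i c' < u i c)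
    (A : N → Finset C) (hPNE : LazyPNE (fun _ n => (n : ℝ)) k lam u A)
    (W : Finset C) (hWdef : W = winners (fun _ n => (n : ℝ)) k A)
    (hssub : W ⊂ Finset.univ.biUnion Wst)
    (w : C) (hwW : w ∈ W) (hwlow : ∀ c ∈ W, c ≠ w → c < w)
    (i : N) (hwtop : owaRank (u i) W w < jstar i)
    (c : C) (hcW : c ∉ W) (hcw : c < w) :
    u i c < u i w := by
  subst hWdef
  by_contra! hle
  have hwc : u i w < u i c := lt_of_le_of_ne hle fun h => hcw.ne' (hu i h)
  set W := winners (fun _ n => (n : ℝ)) k A with hW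
  have hcard : (insert c (W.erase w)).card = k := by
    rw [card_insert_of_notMem (by simp [hcW]), card_erase_add_one hwW]
    exact card_winners_s14 hk2
  have hwin : winners (fun _ n => (n : ℝ)) k (Function.update A i (insert c (W.erase w))) =
      insert c (W.erase w) := by
    refine winners_eq_of_forall_beats hcard fun p hp q hq => ?_
    have hsp := score_update_add A i (insert c (W.erase w)) p
    have hsq := score_update_add A i (insert c (W.erase w)) q
    have hmem : p ∈ A i → 1 ≤ score A p := fun h => card_pos.2 ⟨i, by simp [h]⟩
    rw [if_pos hp] at hsp
    rw [if_neg hq] at hsq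
    have hp1 : 1 ≤ score (Function.update A i (insert c (W.erase w))) p := by grind
    rw [beats_cast_iff]
    by_cases hqw : q = w
    · have hq1 := hPNE.score_le_one hk2 q
      have hpw : p < q := by
        subst hqw
        rcases mem_insert.1 hp with rfl | hp
        · exact hcw
        · exact hwlow p (mem_of_mem_erase hp) (ne_of_mem_erase hp)
      grind
    · have hqW : q ∉ W := fun h => hq (by simp [hqw, h])
      have hq0 := hPNE.score_eq_zero hk2 hqW
      left
      omega
  have hbr := (hPNE i).1 (insert c (W.erase w))
  rw [hwin, Function.update_eq_self, ← hW] at hbr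
  exact (owaUtil_lt_owaUtil_swap (hlam i) (hu i) hwW hcW hwc (hfull i _ hwtop)).not_ge hbr
end
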